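/- There exists C > 0, depending only on the Schottky data, such that for every τ ∈ (0,1] and every x ∈ ℝ, the number of words a ∈ Z(τ) such that x ∈ I_{ā} is at most C. -/

import Mathlib

open Complex MeasureTheory Metric Set
open scoped Real

noncomputable section


abbrev SL2R := Matrix.SpecialLinearGroup (Fin 2) ℝ

/-- Entries of a matrix in `SL(2,ℝ)`, as complex numbers. -/
def mA (g : SL2R) : ℂ := ((g.1 0 0 : ℝ) : ℂ)
def mB (g : SL2R) : ℂ := ((g.1 0 1 : ℝ) : ℂ)
def mC (g : SL2R) : ℂ := ((g.1 1 0 : ℝ) : ℂ)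
def mD (g : SL2R) : ℂ := ((g.1 1 1 : ℝ) : ℂ)

/-- The Möbius action of `SL(2,ℝ)` on the Riemann sphere `ℂ ∪ {∞}`. -/
def moebius (g : SL2R) : OnePoint ℂ → OnePoint ℂ := fun z =>
  match z with
  | OnePoint.infty => if mC g = 0 then OnePoint.infty else ((mA g / mC g : ℂ) : OnePoint ℂ)
  | (w : ℂ) => if mC g * w + mD g = 0 then OnePoint.infty
      else (((mA g * w + mB g) / (mC g * w + mD g) : ℂ) : OnePoint ℂ)

/-- The Möbius action on `ℂ`, with junk value at the pole. -/
def moebiusC (g : SL2R) (z : ℂ) : ℂ := (mA g * z + mB g) / (mC g * z + mD g)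

/-- The Möbius action on `ℝ`, with junk value at the pole. -/
def moebiusR (g : SL2R) (x : ℝ) : ℝ :=
  (g.1 0 0 * x + g.1 0 1) / (g.1 1 0 * x + g.1 1 1)

/-- The complex derivative `γ'(z) = (cz+d)⁻²` of a Möbius transformation (`det = 1`). -/
def dMob (g : SL2R) (z : ℂ) : ℂ := ((mC g * z + mD g)⁻¹) ^ 2

/-- The involution `a ↦ ā` on the alphabet `{1, …, 2r}` (as `Fin (2*r)`). -/
def bar {r : ℕ} (a : Fin (2 * r)) : Fin (2 * r) :=
  if h : (a : ℕ) < r then ⟨(a : ℕ) + r, by omega⟩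
  else ⟨(a : ℕ) - r, by have := a.isLt; omega⟩

/-- Schottky data: `2r` pairwise disjoint closed disks centered on the real axis and
`2r` elements of `SL(2,ℝ)` with `γ_a((ℂ∪{∞}) \ interior D_{ā}) = D_a`, `γ_ā = γ_a⁻¹`. -/
structure Schottky (r : ℕ) where
  hr : 1 ≤ r
  center : Fin (2 * r) → ℝ
  radius : Fin (2 * r) → ℝ
  radius_pos : ∀ a, 0 < radius a
  disj : Pairwise fun a b =>
    Disjoint (closedBall ((center a : ℝ) : ℂ) (radius a)) (closedBall ((center b : ℝ) : ℂ) (radius b))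
  γ : Fin (2 * r) → SL2R
  γ_bar : ∀ a, γ (bar a) = (γ a)⁻¹
  γ_maps : ∀ a, moebius (γ a) ''
      (univ \ ((fun z : ℂ => (z : OnePoint ℂ)) '' interior (closedBall ((center (bar a) : ℝ) : ℂ) (radius (bar a)))))
    = (fun z : ℂ => (z : OnePoint ℂ)) '' closedBall ((center a : ℝ) : ℂ) (radius a)

/-- Words: finite sequences of letters with `a_{j+1} ≠ ā_j`. -/
def IsWord {r : ℕ} (w : List (Fin (2 * r))) : Prop := w.Chain' fun x y => y ≠ bar x

/-- The word `ā := ā_n ⋯ ā_1`. -/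
def barWord {r : ℕ} (w : List (Fin (2 * r))) : List (Fin (2 * r)) := (w.map bar).reverse

namespace Schottky

variable {r : ℕ} (S : Schottky r)

/-- The disk `D_a` for a letter `a`. -/
def disk (a : Fin (2 * r)) : Set ℂ := closedBall ((S.center a : ℝ) : ℂ) (S.radius a)

/-- `γ_w := γ_{a_1} ⋯ γ_{a_n}`. -/
def g (w : List (Fin (2 * r))) : SL2R := (w.map S.γ).prod

/-- The disk `D_w := γ_{w'}(D_{a_n})` of a nonempty word, as a subset of the Riemann sphere. -/
def sdisk : List (Fin (2 * r)) → Set (OnePoint ℂ)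
  | [] => ∅
  | a :: w => moebius (S.g ((a :: w).dropLast)) ''
      ((fun z : ℂ => (z : OnePoint ℂ)) '' S.disk ((a :: w).getLast (List.cons_ne_nil a w)))

/-- The disk `D_w` as a subset of `ℂ`. -/
def wdisk (w : List (Fin (2 * r))) : Set ℂ := {z : ℂ | (z : OnePoint ℂ) ∈ S.sdisk w}

/-- The interval `I_w = D_w ∩ ℝ`, as a subset of `ℝ`. -/
def wint (w : List (Fin (2 * r))) : Set ℝ := {x : ℝ | ((x : ℝ) : ℂ) ∈ S.wdisk w}

/-- The length `|I_w|` of the interval `I_w`. -/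
def wlen (w : List (Fin (2 * r))) : ℝ := Metric.diam (S.wint w)

/-- `D = ⋃_{a ∈ A} D_a`. -/
def D : Set ℂ := ⋃ a, S.disk a

/-- `I = D ∩ ℝ`, as a subset of `ℝ`. -/
def Ire : Set ℝ := {x : ℝ | ((x : ℝ) : ℂ) ∈ S.D}

/-- `D₂ = ⋃_{|w| = 2} D_w`. -/
def D₂ : Set ℂ := ⋃ (a : Fin (2 * r)), ⋃ (b : Fin (2 * r)), ⋃ (_ : b ≠ bar a), S.wdisk [a, b]

/-- `I'_a` for a letter `a`: the convex hull of `⋃_{b ≠ ā} I_{ab}`. -/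
def iprimeLetter (a : Fin (2 * r)) : Set ℝ :=
  convexHull ℝ (⋃ (b : Fin (2 * r)), ⋃ (_ : b ≠ bar a), S.wint [a, b])

/-- `I'_w := γ_{w'}(I'_{a_n})` for a nonempty word `w`. -/
def iprime : List (Fin (2 * r)) → Set ℝ
  | [] => ∅
  | a :: w => moebiusR (S.g ((a :: w).dropLast)) ''
      S.iprimeLetter ((a :: w).getLast (List.cons_ne_nil a w))

/-- The partition `Z(τ)`. -/
def Ztau (τ : ℝ) : Set (List (Fin (2 * r))) :=
  {w | w ≠ [] ∧ IsWord w ∧ S.wlen w ≤ τ ∧ (w.dropLast = [] ∨ τ < S.wlen w.dropLast)}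

/-- The limit set `Λ_Γ ⊂ ℝ`. -/
def limitSet : Set ℝ :=
  {x : ℝ | ∀ n : ℕ, 1 ≤ n → ∃ w : List (Fin (2 * r)), IsWord w ∧ w.length = n ∧ x ∈ S.wint w}

/-- The τ-neighbourhood `Λ_Γ(τ) ⊂ ℝ` of the limit set. -/
def limitSetNbhd (τ : ℝ) : Set ℝ := {x : ℝ | ∃ y ∈ S.limitSet, |x - y| ≤ τ}

end Schottky

/-- `ℓ` is a holomorphic branch on `U` of the logarithm of the derivative of the Möbius
transformation of `g`, real on `U ∩ ℝ`. -/
structure IsLogBranch (g : SL2R) (U : Set ℂ) (ℓ : ℂ → ℂ) : Prop where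
  holo : DifferentiableOn ℂ ℓ U
  exp_eq : ∀ z ∈ U, Complex.exp (ℓ z) = dMob g z
  real_on : ∀ x : ℝ, ((x : ℝ) : ℂ) ∈ U → (ℓ ((x : ℝ) : ℂ)).im = 0

/-- A family of branches `ℓ a b` of `log γ_a'` on `D_b`, for all `a ≠ b̄`. -/
def IsBranchFamily {r : ℕ} (S : Schottky r) (ℓ : Fin (2 * r) → Fin (2 * r) → ℂ → ℂ) : Prop :=
  ∀ a b : Fin (2 * r), a ≠ bar b → IsLogBranch (S.γ a) (S.disk b) (ℓ a b)

/-- The fixed-point equation `L_s u = u` on the interior of `D`, written pointwise. -/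
def TransferFixed {r : ℕ} (S : Schottky r) (s : ℂ)
    (ℓ : Fin (2 * r) → Fin (2 * r) → ℂ → ℂ) (u : ℂ → ℂ) : Prop :=
  ∀ b : Fin (2 * r), ∀ z ∈ interior (S.disk b),
    u z = ∑ a : Fin (2 * r), if a ≠ bar b then
      Complex.exp (s * ℓ a b z) * u (moebiusC (S.γ a) z) else 0

/-- The transfer operator `L_s`, as an operator on functions. -/
def transferOp {r : ℕ} (S : Schottky r) (s : ℂ)
    (ℓ : Fin (2 * r) → Fin (2 * r) → ℂ → ℂ) (u : ℂ → ℂ) : ℂ → ℂ := fun z =>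
  ∑ b : Fin (2 * r), (S.disk b).indicator
    (fun w => ∑ a : Fin (2 * r), if a ≠ bar b then
      Complex.exp (s * ℓ a b w) * u (moebiusC (S.γ a) w) else 0) z

/-- A partition: a finite set of nonempty words such that every long enough word
has exactly one prefix in it. -/
def IsPartition {r : ℕ} (S : Schottky r) (Z : Finset (List (Fin (2 * r)))) : Prop :=
  (∀ w ∈ Z, w ≠ [] ∧ IsWord w) ∧
  ∃ N : ℕ, ∀ w : List (Fin (2 * r)), IsWord w → N ≤ w.length →
    ∃! p : List (Fin (2 * r)), p ∈ Z ∧ p <+: w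

/-- An element of `SL(2,ℝ)` as an element of `GL(2,ℂ)`. -/
def toGLC (g : SL2R) : GL (Fin 2) ℂ :=
  Matrix.SpecialLinearGroup.toGL (Matrix.SpecialLinearGroup.map (algebraMap ℝ ℂ) g)

open Classical in
theorem moebius_eq_smul (g : SL2R) (z : OnePoint ℂ) : moebius g z = toGLC g • z := by
  induction z using OnePoint.rec with
  | infty =>
    rw [OnePoint.smul_infty_eq_ite]
    by_cases h : mC g = 0 <;>
      simp_all [moebius, toGLC, mA, mC]
  | coe w =>
    rw [OnePoint.smul_some_eq_ite]
    by_cases h : mC g * w + mD g = 0 <;>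
      simp_all [moebius, toGLC, mA, mB, mC, mD]

theorem moebius_mul (g h : SL2R) (z : OnePoint ℂ) :
    moebius (g * h) z = moebius g (moebius h z) := by
  classical
  simp only [moebius_eq_smul, toGLC, map_mul, mul_smul]

theorem moebius_one (z : OnePoint ℂ) : moebius 1 z = z := by
  classical
  simp only [moebius_eq_smul, toGLC, map_one, one_smul]

theorem moebius_injective (g : SL2R) : Function.Injective (moebius g) := by
  intro x y h
  have := congrArg (moebius g⁻¹) h
  simpa only [← moebius_mul, inv_mul_cancel, moebius_one] using this

theorem bar_bar {r : ℕ} (a : Fin (2 * r)) : bar (bar a) = a := by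
  have := a.isLt
  by_cases h : (a : ℕ) < r
  · have h' : ¬ (a : ℕ) + r < r := by omega
    simp [bar, h]
  · have h' : (a : ℕ) - r < r := by omega
    ext
    simp only [bar, h, h', dif_pos, dif_neg, not_false_eq_true]
    omega

theorem bar_ne {r : ℕ} (a : Fin (2 * r)) : bar a ≠ a := by
  have := a.isLt
  rw [Ne, Fin.ext_iff]
  simp only [bar]
  split_ifs <;> dsimp only at * <;> omega

theorem IsWord.barWord {r : ℕ} {w : List (Fin (2 * r))} (h : IsWord w) : IsWord (barWord w) := by
  change List.IsChain _ _ at h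
  change List.IsChain _ (List.reverse _)
  rw [List.isChain_reverse, List.isChain_map]
  refine h.imp fun a b hab => ?_
  rw [bar_bar]
  exact hab.symm

theorem barWord_barWord {r : ℕ} (w : List (Fin (2 * r))) : barWord (barWord w) = w := by
  simp [barWord, List.map_reverse, Function.comp_def, bar_bar]

theorem length_barWord {r : ℕ} (w : List (Fin (2 * r))) : (barWord w).length = w.length := by
  simp [barWord]

theorem barWord_append {r : ℕ} (u v : List (Fin (2 * r))) :
    barWord (u ++ v) = barWord v ++ barWord u := by
  simp [barWord]

theorem isWord_append {r : ℕ} {u v : List (Fin (2 * r))} :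
    IsWord (u ++ v) ↔ IsWord u ∧ IsWord v ∧ ∀ x ∈ u.getLast?, ∀ y ∈ v.head?, y ≠ bar x :=
  List.isChain_append

theorem isWord_cons_cons {r : ℕ} {a b : Fin (2 * r)} {w : List (Fin (2 * r))} :
    IsWord (a :: b :: w) ↔ b ≠ bar a ∧ IsWord (b :: w) :=
  List.isChain_cons_cons

namespace Schottky

variable {r : ℕ} (S : Schottky r)

theorem g_append (u v : List (Fin (2 * r))) : S.g (u ++ v) = S.g u * S.g v := by
  simp [g]

theorem g_barWord (w : List (Fin (2 * r))) : S.g (barWord w) = (S.g w)⁻¹ := by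
  induction w with
  | nil => simp [barWord, g]
  | cons a w ih =>
    rw [← List.singleton_append, barWord_append, g_append, g_append, ih, mul_inv_rev]
    simp [barWord, g, S.γ_bar]

/-- The disk `D_a` in the Riemann sphere. -/
def letterDisk (a : Fin (2 * r)) : Set (OnePoint ℂ) := (fun z : ℂ => (z : OnePoint ℂ)) '' S.disk a

theorem disjoint_letterDisk {a b : Fin (2 * r)} (h : a ≠ b) :
    Disjoint (S.letterDisk a) (S.letterDisk b) :=
  (Set.disjoint_image_iff OnePoint.coe_injective).2 (S.disj h)

theorem moebius_γ_mem {a : Fin (2 * r)} {z : OnePoint ℂ} (h : z ∉ S.letterDisk (bar a)) :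
    moebius (S.γ a) z ∈ S.letterDisk a := by
  rw [letterDisk, disk, ← S.γ_maps a]
  refine mem_image_of_mem _ ⟨mem_univ _, fun h' => h ?_⟩
  exact image_mono interior_subset h'

theorem moebius_g_infty_mem {a : Fin (2 * r)} {w : List (Fin (2 * r))} (h : IsWord (a :: w)) :
    moebius (S.g (a :: w)) OnePoint.infty ∈ S.letterDisk a := by
  induction w generalizing a with
  | nil =>
    have : S.g [a] = S.γ a := by simp [g]
    rw [this]
    exact S.moebius_γ_mem (by simp [letterDisk])
  | cons b w ih =>
    rw [isWord_cons_cons] at h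
    have : S.g (a :: b :: w) = S.γ a * S.g (b :: w) := by simp [g]
    rw [this, moebius_mul]
    exact S.moebius_γ_mem ((S.disjoint_letterDisk h.1).notMem_of_mem_left (ih h.2))

theorem lower_left_ne_zero_and_mem_disk_of_moebius {S : Schottky r} {g : SL2R} {a : Fin (2 * r)}
    (h : moebius g OnePoint.infty ∈ S.letterDisk a) :
    g.1 1 0 ≠ 0 ∧ ((g.1 0 0 / g.1 1 0 : ℝ) : ℂ) ∈ S.disk a := by
  obtain ⟨z, hz, h⟩ := h
  by_cases hc : g.1 1 0 = 0
  · simp [moebius, mC, hc] at h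
  · refine ⟨hc, ?_⟩
    simp only [moebius, mC, mA, Complex.ofReal_eq_zero, hc, if_false] at h
    rw [OnePoint.coe_eq_coe] at h
    rw [Complex.ofReal_div, ← h]
    exact hz

theorem lower_left_ne_zero {w : List (Fin (2 * r))} (h : IsWord w) (hw : w ≠ []) :
    (S.g w).1 1 0 ≠ 0 := by
  obtain ⟨a, w, rfl⟩ := List.exists_cons_of_ne_nil hw
  exact (lower_left_ne_zero_and_mem_disk_of_moebius (S.moebius_g_infty_mem h)).1

theorem image_infty_mem {a : Fin (2 * r)} {w : List (Fin (2 * r))} (h : IsWord (a :: w)) :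
    (((S.g (a :: w)).1 0 0 / (S.g (a :: w)).1 1 0 : ℝ) : ℂ) ∈ S.disk a :=
  (lower_left_ne_zero_and_mem_disk_of_moebius (S.moebius_g_infty_mem h)).2

theorem pole_mem {a : Fin (2 * r)} {w : List (Fin (2 * r))} (h : IsWord (w ++ [a])) :
    ((-(S.g (w ++ [a])).1 1 1 / (S.g (w ++ [a])).1 1 0 : ℝ) : ℂ) ∈ S.disk (bar a) := by
  have h1 : barWord (w ++ [a]) = bar a :: barWord w := by simp [barWord]
  have h2 := S.image_infty_mem (h1 ▸ h.barWord)
  rw [← h1, g_barWord, Matrix.SpecialLinearGroup.SL2_inv_expl] at h2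
  simpa [neg_div, div_neg] using h2

theorem sdisk_eq {w : List (Fin (2 * r))} (hw : w ≠ []) :
    S.sdisk w = moebius (S.g w.dropLast) '' S.letterDisk (w.getLast hw) := by
  cases w with
  | nil => exact absurd rfl hw
  | cons a w => rfl

theorem sdisk_append_singleton (w : List (Fin (2 * r))) (b : Fin (2 * r)) :
    S.sdisk (w ++ [b]) = moebius (S.g w) '' S.letterDisk b := by
  simp [S.sdisk_eq (w := w ++ [b]) (by simp)]

theorem sdisk_singleton (b : Fin (2 * r)) : S.sdisk [b] = S.letterDisk b := by
  have := S.sdisk_append_singleton [] b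
  simpa [g, moebius_one, Set.image_id'] using this

theorem sdisk_cons_cons (a b : Fin (2 * r)) (w : List (Fin (2 * r))) :
    S.sdisk (a :: b :: w) = moebius (S.γ a) '' S.sdisk (b :: w) := by
  obtain ⟨v, c, h⟩ := (b :: w).eq_nil_or_concat.resolve_left (List.cons_ne_nil b w)
  rw [h, List.concat_eq_append, ← List.cons_append, sdisk_append_singleton,
    sdisk_append_singleton, image_image]
  simp only [← moebius_mul]
  simp [g]

theorem sdisk_cons_subset {a : Fin (2 * r)} {w : List (Fin (2 * r))} (h : IsWord (a :: w)) :
    S.sdisk (a :: w) ⊆ S.letterDisk a := by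
  induction w generalizing a with
  | nil => rw [sdisk_singleton]
  | cons b w ih =>
    rw [isWord_cons_cons] at h
    rw [sdisk_cons_cons]
    rintro _ ⟨z, hz, rfl⟩
    exact S.moebius_γ_mem ((S.disjoint_letterDisk h.1).notMem_of_mem_left (ih h.2 hz))

theorem isPrefix_of_mem_sdisk {u v : List (Fin (2 * r))} (hu : IsWord u) (hv : IsWord v)
    {z : OnePoint ℂ} (hzu : z ∈ S.sdisk u) (hzv : z ∈ S.sdisk v) (hl : u.length ≤ v.length) :
    u <+: v := by
  induction u generalizing v z with
  | nil => exact ⟨_, List.nil_append _⟩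
  | cons a u ih =>
    cases v with
    | nil => simp at hl
    | cons b v =>
      have hab : a = b := by
        by_contra hne
        exact (S.disjoint_letterDisk hne).le_bot
          ⟨S.sdisk_cons_subset hu hzu, S.sdisk_cons_subset hv hzv⟩
      subst hab
      refine List.cons_prefix_cons.2 ⟨rfl, ?_⟩
      cases u with
      | nil => exact ⟨_, List.nil_append _⟩
      | cons c u =>
        cases v with
        | nil => simp at hl
        | cons d v =>
          rw [sdisk_cons_cons] at hzu hzv
          obtain ⟨x, hx, rfl⟩ := hzu
          obtain ⟨y, hy, hxy⟩ := hzv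
          rw [moebius_injective _ hxy] at hy
          exact ih (isWord_cons_cons.1 hu).2 (isWord_cons_cons.1 hv).2 hx hy (by simpa using hl)

theorem exists_separation :
    ∃ δ > 0, ∀ a b, a ≠ b → ∀ z ∈ S.disk a, ∀ z' ∈ S.disk b, δ ≤ ‖z - z'‖ := by
  classical
  let f : Fin (2 * r) × Fin (2 * r) → ℝ := fun p =>
    if p.1 = p.2 then 1 else
      dist (S.center p.1 : ℂ) (S.center p.2 : ℂ) - (S.radius p.1 + S.radius p.2)
  have hf : ∀ p, 0 < f p := by
    rintro ⟨a, b⟩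
    by_cases hab : a = b
    · simp [f, hab]
    · have := (disjoint_closedBall_closedBall_iff (S.radius_pos a).le (S.radius_pos b).le).1
        (S.disj hab)
      simp only [f, hab, if_false]
      linarith
  have : Nonempty (Fin (2 * r)) := ⟨⟨0, by have := S.hr; omega⟩⟩
  obtain ⟨p, hp⟩ := Finite.exists_min f
  refine ⟨f p, hf p, fun a b hab z hz z' hz' => (hp (a, b)).trans ?_⟩
  simp only [f, hab, if_false]
  rw [disk, mem_closedBall] at hz hz'
  have h1 := dist_triangle4 (S.center a : ℂ) z z' (S.center b : ℂ)
  rw [dist_comm _ z, dist_eq_norm z z'] at h1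
  linarith

theorem exists_norm_le : ∃ R > 0, ∀ a, ∀ z ∈ S.disk a, ‖z‖ ≤ R := by
  have : Bornology.IsBounded (⋃ a, S.disk a) :=
    Bornology.isBounded_iUnion.2 fun a => isBounded_closedBall
  obtain ⟨R, hR, h⟩ := this.exists_pos_norm_le
  exact ⟨R, hR, fun a z hz => h z (mem_iUnion_of_mem a hz)⟩

/-- The absolute value of the lower left entry of `γ_w`. -/
def lowerLeft (w : List (Fin (2 * r))) : ℝ := |(S.g w).1 1 0|

/-- The point `γ_w(∞)`. -/
def imageInfty (w : List (Fin (2 * r))) : ℝ := (S.g w).1 0 0 / (S.g w).1 1 0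

variable {S} {δ R : ℝ}

theorem lowerLeft_pos (S : Schottky r) {w : List (Fin (2 * r))} (h : IsWord w) (hw : w ≠ []) :
    0 < S.lowerLeft w :=
  abs_pos.2 (S.lower_left_ne_zero h hw)

theorem abs_imageInfty_le (hR : ∀ a, ∀ z ∈ S.disk a, ‖z‖ ≤ R) {w : List (Fin (2 * r))}
    (h : IsWord w) (hw : w ≠ []) : |S.imageInfty w| ≤ R := by
  obtain ⟨a, w, rfl⟩ := List.exists_cons_of_ne_nil hw
  simpa only [Complex.norm_real, Real.norm_eq_abs, imageInfty] using hR _ _ (S.image_infty_mem h)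

/-- On a disk `D_b` with `wb` a word, the denominator of `γ_w` is comparable to `|c_w|`. -/
theorem norm_denom_bounds
    (hδ : ∀ a b, a ≠ b → ∀ z ∈ S.disk a, ∀ z' ∈ S.disk b, δ ≤ ‖z - z'‖)
    (hR : ∀ a, ∀ z ∈ S.disk a, ‖z‖ ≤ R) {w : List (Fin (2 * r))} {b : Fin (2 * r)}
    (h : IsWord (w ++ [b])) (hw : w ≠ []) {z : ℂ} (hz : z ∈ S.disk b) :
    S.lowerLeft w * δ ≤ ‖mC (S.g w) * z + mD (S.g w)‖ ∧
      ‖mC (S.g w) * z + mD (S.g w)‖ ≤ S.lowerLeft w * (2 * R) := by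
  obtain ⟨v, a, rfl⟩ := w.eq_nil_or_concat.resolve_left hw
  rw [List.concat_eq_append] at *
  obtain ⟨hv, -, hab⟩ := isWord_append.1 h
  have hab : b ≠ bar a := hab a (by simp) b (by simp)
  have hp := S.pole_mem hv
  have hc := S.lower_left_ne_zero hv hw
  set G := S.g (v ++ [a]) with hG
  have hc' : (G.1 1 0 : ℂ) ≠ 0 := by exact_mod_cast hc
  have key : mC G * z + mD G = G.1 1 0 * (z - ((-G.1 1 1 / G.1 1 0 : ℝ) : ℂ)) := by
    simp only [mC, mD]
    push_cast
    field_simp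
    ring
  have hl : S.lowerLeft (v ++ [a]) = |G.1 1 0| := rfl
  rw [key, norm_mul, Complex.norm_real, Real.norm_eq_abs, hl]
  constructor
  · gcongr
    exact hδ _ _ hab _ hz _ hp
  · gcongr
    calc _ ≤ _ := norm_sub_le _ _
      _ ≤ R + R := add_le_add (hR _ _ hz) (hR _ _ hp)
      _ = _ := by ring

theorem lowerLeft_append_bounds
    (hδ : ∀ a b, a ≠ b → ∀ z ∈ S.disk a, ∀ z' ∈ S.disk b, δ ≤ ‖z - z'‖)
    (hR : ∀ a, ∀ z ∈ S.disk a, ‖z‖ ≤ R) {u v : List (Fin (2 * r))}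
    (h : IsWord (u ++ v)) (hu : u ≠ []) (hv : v ≠ []) :
    S.lowerLeft u * δ * S.lowerLeft v ≤ S.lowerLeft (u ++ v) ∧
      S.lowerLeft (u ++ v) ≤ S.lowerLeft u * (2 * R) * S.lowerLeft v := by
  obtain ⟨b, v, rfl⟩ := List.exists_cons_of_ne_nil hv
  have h' : IsWord (u ++ [b]) := by
    rw [List.append_cons] at h
    exact (isWord_append.1 h).1
  have hvw : IsWord (b :: v) := (isWord_append.1 h).2.1
  have hb := norm_denom_bounds hδ hR h' hu (S.image_infty_mem hvw)
  have hc := S.lower_left_ne_zero hvw hv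
  have key : S.lowerLeft (u ++ b :: v) =
      ‖mC (S.g u) * ((S.imageInfty (b :: v) : ℝ) : ℂ) + mD (S.g u)‖ * S.lowerLeft (b :: v) := by
    rw [lowerLeft, g_append, lowerLeft, imageInfty, mC, mD, ← Complex.ofReal_mul,
      ← Complex.ofReal_add, Complex.norm_real, Real.norm_eq_abs, ← abs_mul]
    congr 1
    rw [Matrix.SpecialLinearGroup.coe_mul, Matrix.mul_apply, Fin.sum_univ_two]
    field_simp
  rw [key]
  have := S.lowerLeft_pos hvw hv
  exact ⟨by gcongr; exact hb.1, by gcongr; exact hb.2⟩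

theorem le_abs_imageInfty_sub
    (hδ : ∀ a b, a ≠ b → ∀ z ∈ S.disk a, ∀ z' ∈ S.disk b, δ ≤ ‖z - z'‖)
    (hR0 : 0 < R) (hR : ∀ a, ∀ z ∈ S.disk a, ‖z‖ ≤ R) {u v : List (Fin (2 * r))}
    (h : IsWord (u ++ v)) (hu : u ≠ []) (hv : v ≠ []) :
    1 / (2 * R * S.lowerLeft u ^ 2) ≤ |S.imageInfty u - S.imageInfty (u ++ v)| := by
  have huw := (isWord_append.1 h).1
  have hvw := (isWord_append.1 h).2.1
  have hcu := S.lower_left_ne_zero huw hu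
  have hcuv := S.lower_left_ne_zero h (by simp [hu])
  have hpu := S.lowerLeft_pos huw hu
  have hpv := S.lowerLeft_pos hvw hv
  have hpuv := S.lowerLeft_pos h (by simp [hu])
  have key : |S.imageInfty u - S.imageInfty (u ++ v)| =
      S.lowerLeft v / (S.lowerLeft u * S.lowerLeft (u ++ v)) := by
    rw [imageInfty, imageInfty, div_sub_div _ _ hcu hcuv, abs_div, abs_mul, lowerLeft, lowerLeft,
      lowerLeft]
    congr 2
    have hdet := Matrix.det_fin_two (S.g u).1
    rw [(S.g u).2] at hdet
    rw [g_append, Matrix.SpecialLinearGroup.coe_mul, Matrix.mul_apply, Matrix.mul_apply,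
      Fin.sum_univ_two, Fin.sum_univ_two]
    linear_combination (-(S.g v).1 1 0) * hdet
  rw [key, div_le_div_iff₀ (by positivity) (by positivity)]
  have := (lowerLeft_append_bounds hδ hR h hu hv).2
  nlinarith [mul_le_mul_of_nonneg_left this hpu.le]

theorem le_lowerLeft
    (hδ : ∀ a b, a ≠ b → ∀ z ∈ S.disk a, ∀ z' ∈ S.disk b, δ ≤ ‖z - z'‖)
    (hR0 : 0 < R) (hR : ∀ a, ∀ z ∈ S.disk a, ‖z‖ ≤ R) {w : List (Fin (2 * r))}
    (h : IsWord w) (hw : w ≠ []) : 1 / (2 * R) ≤ S.lowerLeft w := by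
  obtain ⟨v, a, rfl⟩ := w.eq_nil_or_concat.resolve_left hw
  rw [List.concat_eq_append] at *
  have h' : IsWord (v ++ [a] ++ [a]) :=
    isWord_append.2 ⟨h, List.isChain_singleton _, by simpa using (bar_ne a).symm⟩
  have h1 := le_abs_imageInfty_sub hδ hR0 hR h' hw (by simp)
  have h2 := abs_imageInfty_le hR h hw
  have h3 := abs_imageInfty_le hR h' (by simp)
  have h4 := h1.trans (abs_sub _ _)
  have hp := S.lowerLeft_pos h hw
  have h5 : 1 / (2 * R * S.lowerLeft (v ++ [a]) ^ 2) ≤ 2 * R := by linarith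
  rw [div_le_iff₀ (by positivity)] at h5 ⊢
  nlinarith [mul_pos hp hR0]

/-- There are only finitely many possible lengths for a word with bounded `|c_w|`. -/
theorem exists_length_le_of_lowerLeft_le (S : Schottky r) (K : ℝ) :
    ∃ N : ℕ, ∀ w, IsWord w → w ≠ [] → S.lowerLeft w ≤ K → w.length ≤ N := by
  obtain ⟨δ, hδ0, hδ⟩ := S.exists_separation
  obtain ⟨R, hR0, hR⟩ := S.exists_norm_le
  set K' : ℝ := |K| + 1 + |K| * (2 * R) / δ with hK'
  have hK0 : 0 < K' := by positivity
  set η : ℝ := 1 / (2 * R * K' ^ 2) with hη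
  have hη0 : 0 < η := by positivity
  refine ⟨(Finset.Icc ⌊-R / η⌋ ⌊R / η⌋).card, fun w hw hne hwK => ?_⟩
  have htake : ∀ k, 1 ≤ k → k ≤ w.length → IsWord (w.take k) ∧ w.take k ≠ [] := fun k h1 h2 =>
    ⟨(isWord_append.1 ((List.take_append_drop k w).symm ▸ hw)).1, by
      rw [Ne, List.take_eq_nil_iff]; rintro (rfl | rfl) <;> simp_all⟩
  have hbound : ∀ k, 1 ≤ k → k ≤ w.length → S.lowerLeft (w.take k) ≤ K' := by
    intro k h1 h2
    have hwK' : S.lowerLeft w ≤ |K| := hwK.trans (le_abs_self K)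
    have hpos : 0 ≤ |K| * (2 * R) / δ := by positivity
    obtain ⟨ht, htne⟩ := htake k h1 h2
    by_cases hd : w.drop k = []
    · have : w.take k = w := by
        conv_rhs => rw [← List.take_append_drop k w, hd, List.append_nil]
      rw [this]
      linarith
    · have hw' : IsWord (w.take k ++ w.drop k) := by rwa [List.take_append_drop]
      have hb := (lowerLeft_append_bounds hδ hR hw' htne hd).1
      rw [List.take_append_drop] at hb
      have hl := le_lowerLeft hδ hR0 hR (isWord_append.1 hw').2.1 hd
      have hp := S.lowerLeft_pos ht htne
      have : S.lowerLeft (w.take k) * δ * (1 / (2 * R)) ≤ |K| :=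
        (mul_le_mul_of_nonneg_left hl (by positivity)).trans (hb.trans hwK')
      have : S.lowerLeft (w.take k) ≤ |K| * (2 * R) / δ := by
        rw [le_div_iff₀ hδ0]
        rwa [mul_one_div, div_le_iff₀ (by positivity)] at this
      linarith [abs_nonneg K]
  have hsep : ∀ j k, 1 ≤ j → j < k → k ≤ w.length →
      η ≤ |S.imageInfty (w.take j) - S.imageInfty (w.take k)| := by
    intro j k h1 hjk h2
    obtain ⟨hj, hjne⟩ := htake j h1 (by omega)
    obtain ⟨hk, hkne⟩ := htake k (by omega) h2
    have hsplit : w.take k = w.take j ++ (w.take k).drop j := by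
      conv_lhs => rw [← List.take_append_drop j (w.take k), List.take_take, min_eq_left hjk.le]
    have hdne : (w.take k).drop j ≠ [] := by
      rw [Ne, List.drop_eq_nil_iff, List.length_take]
      omega
    have := le_abs_imageInfty_sub hδ hR0 hR (hsplit ▸ hk) hjne hdne
    rw [← hsplit] at this
    refine le_trans ?_ this
    have hp := S.lowerLeft_pos hj hjne
    rw [hη]
    gcongr
    exact hbound j h1 (by omega)
  have hcard := Finset.card_le_card_of_injOn (s := Finset.Icc 1 w.length)
    (t := Finset.Icc ⌊-R / η⌋ ⌊R / η⌋) (fun k => ⌊S.imageInfty (w.take k) / η⌋) ?_ ?_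
  · simpa using hcard
  · intro k hk
    rw [Finset.coe_Icc, Set.mem_Icc] at hk
    obtain ⟨ht, htne⟩ := htake k hk.1 hk.2
    have := abs_le.1 (abs_imageInfty_le hR ht htne)
    rw [Finset.coe_Icc, Set.mem_Icc]
    exact ⟨Int.floor_mono (div_le_div_of_nonneg_right this.1 hη0.le),
      Int.floor_mono (div_le_div_of_nonneg_right this.2 hη0.le)⟩
  · intro j hj k hk hjk
    rw [Finset.coe_Icc, Set.mem_Icc] at hj hk
    have hlt := Int.abs_sub_lt_one_of_floor_eq_floor hjk
    rw [← sub_div, abs_div, abs_of_pos hη0, div_lt_one hη0] at hlt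
    rcases lt_trichotomy j k with h | h | h
    · exact absurd (hsep j k hj.1 h hk.2) (not_le.2 hlt)
    · exact h
    · rw [abs_sub_comm] at hlt
      exact absurd (hsep k j hk.1 h hj.2) (not_le.2 hlt)

theorem norm_div_sub_div (G : SL2R) {z z' : ℂ} (h : mC G * z + mD G ≠ 0)
    (h' : mC G * z' + mD G ≠ 0) :
    ‖(mA G * z + mB G) / (mC G * z + mD G) - (mA G * z' + mB G) / (mC G * z' + mD G)‖ =
      ‖z - z'‖ / (‖mC G * z + mD G‖ * ‖mC G * z' + mD G‖) := by
  rw [div_sub_div _ _ h h', norm_div, norm_mul]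
  congr 2
  have hdet : mA G * mD G - mB G * mC G = 1 := by
    have hdet := Matrix.det_fin_two G.1
    rw [G.2] at hdet
    simp only [mA, mB, mC, mD]
    exact_mod_cast hdet.symm
  linear_combination (z - z') * hdet

theorem mem_wint_append_singleton {w : List (Fin (2 * r))} {b : Fin (2 * r)} {x : ℝ} :
    x ∈ S.wint (w ++ [b]) ↔ ∃ z ∈ S.disk b, moebius (S.g w) z = ((x : ℂ) : OnePoint ℂ) := by
  simp [wint, wdisk, sdisk_append_singleton, letterDisk]

theorem moebius_coe {G : SL2R} {z : ℂ} (h : mC G * z + mD G ≠ 0) :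
    moebius G z = (((mA G * z + mB G) / (mC G * z + mD G) : ℂ) : OnePoint ℂ) := by
  simp [moebius, h]

theorem dist_le_of_mem_wint (hδ0 : 0 < δ)
    (hδ : ∀ a b, a ≠ b → ∀ z ∈ S.disk a, ∀ z' ∈ S.disk b, δ ≤ ‖z - z'‖)
    (hR : ∀ a, ∀ z ∈ S.disk a, ‖z‖ ≤ R) {w : List (Fin (2 * r))} {b : Fin (2 * r)}
    (h : IsWord (w ++ [b])) (hw : w ≠ []) {x y : ℝ} (hx : x ∈ S.wint (w ++ [b]))
    (hy : y ∈ S.wint (w ++ [b])) : dist x y ≤ 2 * R / (S.lowerLeft w * δ) ^ 2 := by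
  rw [mem_wint_append_singleton] at hx hy
  obtain ⟨z, hz, hzx⟩ := hx
  obtain ⟨z', hz', hzy⟩ := hy
  have hp := mul_pos (S.lowerLeft_pos (isWord_append.1 h).1 hw) hδ0
  have hb := (norm_denom_bounds hδ hR h hw hz).1
  have hb' := (norm_denom_bounds hδ hR h hw hz').1
  have h0 := norm_pos_iff.1 (hp.trans_le hb)
  have h0' := norm_pos_iff.1 (hp.trans_le hb')
  rw [moebius_coe h0, OnePoint.coe_eq_coe] at hzx
  rw [moebius_coe h0', OnePoint.coe_eq_coe] at hzy
  have hd : ‖z - z'‖ ≤ 2 * R :=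
    calc _ ≤ _ := norm_sub_le _ _
      _ ≤ R + R := add_le_add (hR _ _ hz) (hR _ _ hz')
      _ = _ := by ring
  rw [Real.dist_eq, ← Real.norm_eq_abs, ← Complex.norm_real, Complex.ofReal_sub, ← hzx, ← hzy,
    norm_div_sub_div _ h0 h0', sq]
  gcongr
  exact (norm_nonneg _).trans hd

theorem wlen_append_singleton_le (hδ0 : 0 < δ)
    (hδ : ∀ a b, a ≠ b → ∀ z ∈ S.disk a, ∀ z' ∈ S.disk b, δ ≤ ‖z - z'‖) (hR0 : 0 < R)
    (hR : ∀ a, ∀ z ∈ S.disk a, ‖z‖ ≤ R) {w : List (Fin (2 * r))} {b : Fin (2 * r)}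
    (h : IsWord (w ++ [b])) (hw : w ≠ []) :
    S.wlen (w ++ [b]) ≤ 2 * R / (S.lowerLeft w * δ) ^ 2 :=
  Metric.diam_le_of_forall_dist_le (by positivity) fun _ hx _ hy =>
    dist_le_of_mem_wint hδ0 hδ hR h hw hx hy

theorem le_wlen_append_singleton (hδ0 : 0 < δ)
    (hδ : ∀ a b, a ≠ b → ∀ z ∈ S.disk a, ∀ z' ∈ S.disk b, δ ≤ ‖z - z'‖)
    (hR : ∀ a, ∀ z ∈ S.disk a, ‖z‖ ≤ R) {w : List (Fin (2 * r))} {b : Fin (2 * r)}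
    (h : IsWord (w ++ [b])) (hw : w ≠ []) :
    S.radius b / (S.lowerLeft w * (2 * R)) ^ 2 ≤ S.wlen (w ++ [b]) := by
  have hbdd : Bornology.IsBounded (S.wint (w ++ [b])) :=
    Metric.isBounded_iff.2 ⟨_, fun _ hx _ hy => dist_le_of_mem_wint hδ0 hδ hR h hw hx hy⟩
  have hr := S.radius_pos b
  have hz : ((S.center b : ℝ) : ℂ) ∈ S.disk b := mem_closedBall_self hr.le
  have hz' : ((S.center b + S.radius b : ℝ) : ℂ) ∈ S.disk b := by
    simp [disk, abs_of_pos hr]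
  have hp := mul_pos (S.lowerLeft_pos (isWord_append.1 h).1 hw) hδ0
  have hb := norm_denom_bounds hδ hR h hw hz
  have hb' := norm_denom_bounds hδ hR h hw hz'
  have h0 := norm_pos_iff.1 (hp.trans_le hb.1)
  have h0' := norm_pos_iff.1 (hp.trans_le hb'.1)
  have hmem : ∀ t : ℝ, (t : ℂ) ∈ S.disk b → mC (S.g w) * t + mD (S.g w) ≠ 0 →
      moebiusR (S.g w) t ∈ S.wint (w ++ [b]) := by
    intro t ht ht0
    refine mem_wint_append_singleton.2 ⟨t, ht, ?_⟩
    rw [moebius_coe ht0, moebiusR, mA, mB, mC, mD]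
    push_cast
    rfl
  refine le_trans ?_ (Metric.dist_le_diam_of_mem hbdd (hmem _ hz h0) (hmem _ hz' h0'))
  have key : dist (moebiusR (S.g w) (S.center b)) (moebiusR (S.g w) (S.center b + S.radius b)) =
      S.radius b / (‖mC (S.g w) * (S.center b : ℝ) + mD (S.g w)‖ *
        ‖mC (S.g w) * ((S.center b + S.radius b : ℝ) : ℂ) + mD (S.g w)‖) := by
    have h1 := norm_div_sub_div (S.g w) h0 h0'
    have h2 : ‖((S.center b : ℝ) : ℂ) - ((S.center b + S.radius b : ℝ) : ℂ)‖ = S.radius b := by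
      simp [abs_of_pos hr]
    rw [h2] at h1
    rw [← h1, Real.dist_eq, ← Real.norm_eq_abs, ← Complex.norm_real]
    congr 1
    simp only [moebiusR, mA, mB, mC, mD]
    push_cast
    rfl
  rw [key, sq]
  gcongr
  · exact (norm_nonneg _).trans hb.2
  · exact hb.2
  · exact hb'.2

/-- If `w` and `uw` belong to `Z(τ)` and `w` has at least two letters, then `u` has bounded
length, uniformly in `τ`. -/
theorem exists_length_le_of_append_mem_Ztau (S : Schottky r) :
    ∃ N : ℕ, ∀ τ : ℝ, 0 < τ → ∀ u w : List (Fin (2 * r)), w ∈ S.Ztau τ → u ++ w ∈ S.Ztau τ →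
      2 ≤ w.length → u.length ≤ N := by
  obtain ⟨δ, hδ0, hδ⟩ := S.exists_separation
  obtain ⟨R, hR0, hR⟩ := S.exists_norm_le
  have : Nonempty (Fin (2 * r)) := ⟨⟨0, by have := S.hr; omega⟩⟩
  obtain ⟨b₀, hb₀⟩ := Finite.exists_min S.radius
  obtain ⟨b₁, hb₁⟩ := Finite.exists_max fun b => S.lowerLeft [b]
  set ρ := S.radius b₀
  have hρ : 0 < ρ := S.radius_pos b₀
  set M := S.lowerLeft [b₁]
  obtain ⟨N, hN⟩ := S.exists_length_le_of_lowerLeft_le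
    (1 + 2 * R * ((2 * R) * M) ^ 2 * (2 * R) ^ 2 / (ρ * δ ^ 4))
  refine ⟨N, fun τ hτ u w hw huw hlen => ?_⟩
  rcases eq_or_ne u [] with rfl | hu
  · simp
  obtain ⟨v, a, rfl⟩ := w.eq_nil_or_concat.resolve_left (by rintro rfl; simp at hlen)
  rw [List.concat_eq_append] at *
  have hv : v ≠ [] := by rintro rfl; simp at hlen
  obtain ⟨y, b, rfl⟩ := v.eq_nil_or_concat.resolve_left hv
  rw [List.concat_eq_append] at *
  obtain ⟨-, hww, hwτ, -⟩ := hw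
  obtain ⟨-, huww, -, hdrop⟩ := huw
  have hlow := (le_wlen_append_singleton hδ0 hδ hR hww hv).trans hwτ
  rw [← List.append_assoc] at huww hdrop
  have huyb : IsWord (u ++ (y ++ [b])) := (isWord_append.1 huww).1
  rw [List.dropLast_concat] at hdrop
  have hup := hdrop.resolve_left (by simp)
  have huyb' := huyb
  rw [← List.append_assoc] at hup huyb'
  have huy0 : u ++ y ≠ [] := by simp [hu]
  replace hup := hup.trans_le (wlen_append_singleton_le hδ0 hδ hR0 hR huyb' huy0)
  have huyw := (isWord_append.1 huyb').1
  have hu_w := (isWord_append.1 huyb).1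
  have h1 := (lowerLeft_append_bounds hδ hR huyb hu hv).1
  have h2 := (lowerLeft_append_bounds hδ hR huyb' huy0 (by simp)).2
  rw [List.append_assoc] at h2
  have h3 := hb₁ b
  have h4 := hb₀ a
  have p1 := S.lowerLeft_pos hu_w hu
  have p2 := S.lowerLeft_pos (isWord_append.1 hww).1 hv
  have p3 := S.lowerLeft_pos huyw huy0
  refine hN u hu_w hu ?_
  set cu := S.lowerLeft u
  set cy := S.lowerLeft (y ++ [b])
  set cuy := S.lowerLeft (u ++ y)
  have h5 : cu * δ * cy ≤ cuy * (2 * R) * M :=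
    h1.trans (h2.trans (mul_le_mul_of_nonneg_left h3 (by positivity)))
  have h6 : ρ / (cy * (2 * R)) ^ 2 < 2 * R / (cuy * δ) ^ 2 :=
    lt_of_le_of_lt ((div_le_div_of_nonneg_right h4 (by positivity)).trans hlow) hup
  rw [div_lt_div_iff₀ (by positivity) (by positivity)] at h6
  have h7 : (cu * δ * cy) ^ 2 ≤ (cuy * (2 * R) * M) ^ 2 := by gcongr
  have h8 : cu ^ 2 ≤ 2 * R * ((2 * R) * M) ^ 2 * (2 * R) ^ 2 / (ρ * δ ^ 4) := by
    rw [le_div_iff₀ (by positivity)]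
    have h9 : cu ^ 2 * (ρ * δ ^ 4) * cy ^ 2 ≤
        2 * R * ((2 * R) * M) ^ 2 * (2 * R) ^ 2 * cy ^ 2 :=
      calc cu ^ 2 * (ρ * δ ^ 4) * cy ^ 2 = (ρ * δ ^ 2) * (cu * δ * cy) ^ 2 := by ring
        _ ≤ (ρ * δ ^ 2) * (cuy * (2 * R) * M) ^ 2 := by gcongr
        _ = ((2 * R) * M) ^ 2 * (ρ * (cuy * δ) ^ 2) := by ring
        _ ≤ ((2 * R) * M) ^ 2 * (2 * R * (cy * (2 * R)) ^ 2) := by gcongr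
        _ = _ := by ring
    exact le_of_mul_le_mul_right h9 (by positivity)
  nlinarith [sq_nonneg (cu - 1)]

theorem suffix_of_mem_wint_barWord {w w' : List (Fin (2 * r))} (hw : IsWord w) (hw' : IsWord w')
    {x : ℝ} (hx : x ∈ S.wint (barWord w)) (hx' : x ∈ S.wint (barWord w'))
    (hl : w.length ≤ w'.length) : w <:+ w' := by
  obtain ⟨t, ht⟩ := S.isPrefix_of_mem_sdisk hw.barWord hw'.barWord hx hx'
    (by simpa only [length_barWord] using hl)
  refine ⟨barWord t, ?_⟩
  rw [← barWord_barWord w', ← ht, barWord_append, barWord_barWord]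

end Schottky


/-- There is `C > 0` depending only on the Schottky data such that for every
`τ ∈ (0,1]` and `x ∈ ℝ`, the number of words `a ∈ Z(τ)` with `x ∈ I_{ā}` is at most `C`. -/
theorem stmt15 {r : ℕ} (S : Schottky r) :
    ∃ C : ℝ, 0 < C ∧ ∀ τ ∈ Set.Ioc (0 : ℝ) 1, ∀ x : ℝ,
      {w : List (Fin (2 * r)) | w ∈ S.Ztau τ ∧ x ∈ S.wint (barWord w)}.Finite ∧
      (Nat.card {w : List (Fin (2 * r)) | w ∈ S.Ztau τ ∧ x ∈ S.wint (barWord w)} : ℝ) ≤ C := by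
  obtain ⟨N, hN⟩ := S.exists_length_le_of_append_mem_Ztau
  refine ⟨N + 2, by positivity, fun τ hτ x => ?_⟩
  set T := {w : List (Fin (2 * r)) | w ∈ S.Ztau τ ∧ x ∈ S.wint (barWord w)} with hT
  have hinj : InjOn List.length T := fun w hw w' hw' hl =>
    (Schottky.suffix_of_mem_wint_barWord hw.1.2.1 hw'.1.2.1 hw.2 hw'.2 hl.le).eq_of_length hl
  obtain ⟨n, hn⟩ : ∃ n, ∀ w ∈ T, w.length ∈ insert 1 (Finset.Icc n (n + N)) := by
    by_cases hne : ∃ n, ∃ w ∈ T, 2 ≤ w.length ∧ w.length = n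
    · classical
      obtain ⟨w, hw, hw2, hwn⟩ := Nat.find_spec hne
      refine ⟨Nat.find hne, fun w' hw' => ?_⟩
      rw [Finset.mem_insert, Finset.mem_Icc]
      have h0 := List.length_pos_of_ne_nil hw'.1.1
      rcases lt_or_ge w'.length 2 with h | h
      · left
        omega
      · right
        have hmin := Nat.find_min' hne ⟨w', hw', h, rfl⟩
        refine ⟨hmin, ?_⟩
        obtain ⟨u, rfl⟩ := Schottky.suffix_of_mem_wint_barWord hw.1.2.1 hw'.1.2.1 hw.2 hw'.2
          (hwn.trans_le hmin)
        have := hN τ hτ.1 u w hw.1 hw'.1 hw2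
        rw [List.length_append]
        omega
    · refine ⟨0, fun w hw => Finset.mem_insert.2 (Or.inl ?_)⟩
      have h0 := List.length_pos_of_ne_nil hw.1.1
      by_contra h
      exact hne ⟨_, w, hw, by omega, rfl⟩
  have hmaps : MapsTo List.length T (insert 1 (Finset.Icc n (n + N)) : Finset ℕ) := hn
  refine ⟨Set.Finite.of_injOn hmaps hinj (Finset.finite_toSet _), ?_⟩
  have hcard := Set.ncard_le_ncard_of_injOn List.length hmaps hinj (Finset.finite_toSet _)
  rw [Set.ncard_coe_finset] at hcard
  have h2 := Finset.card_insert_le 1 (Finset.Icc n (n + N))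
  rw [Nat.card_Icc] at h2
  have : Nat.card T ≤ N + 2 := hcard.trans (by omega)
  exact_mod_cast this
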